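/- Let G be a finite connected graph that is claw-free and bull-free. If G contains an induced cycle C of length k ≥ 6, then G is an expansion of the cycle graph C_k of length k. -/

import Mathlib

/-- A graph is claw-free: no induced `K_{1,3}`. -/
def ClawFree {V : Type*} (G : SimpleGraph V) : Prop :=
  ¬ ∃ v a b c : V, a ≠ b ∧ a ≠ c ∧ b ≠ c ∧
    G.Adj v a ∧ G.Adj v b ∧ G.Adj v c ∧ ¬ G.Adj a b ∧ ¬ G.Adj a c ∧ ¬ G.Adj b c

/-- A graph is bull-free: no induced bull (triangle `a b c` with pendants `d` at `a`
and `e` at `b`). -/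
def BullFree {V : Type*} (G : SimpleGraph V) : Prop :=
  ¬ ∃ a b c d e : V, a ≠ e ∧ b ≠ d ∧ c ≠ d ∧ c ≠ e ∧ d ≠ e ∧
    G.Adj a b ∧ G.Adj b c ∧ G.Adj c a ∧ G.Adj a d ∧ G.Adj b e ∧
    ¬ G.Adj b d ∧ ¬ G.Adj c d ∧ ¬ G.Adj a e ∧ ¬ G.Adj c e ∧ ¬ G.Adj d e
/-- `v : ZMod k → V` is an induced cycle of length `k` in `G`: the vertices are distinct and
two of them are adjacent iff their indices differ by `±1` modulo `k`. -/
def IsInducedCycle {V : Type*} (G : SimpleGraph V) (k : ℕ) (v : ZMod k → V) : Prop :=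
  Function.Injective v ∧ ∀ i j : ZMod k, G.Adj (v i) (v j) ↔ (i - j = 1 ∨ j - i = 1)
/-- `G` is an expansion of the path with `n + 1` vertices. -/
def IsPathExpansion {V : Type*} (G : SimpleGraph V) (n : ℕ) : Prop :=
  ∃ f : V → Fin (n + 1), Function.Surjective f ∧
    ∀ x y : V, x ≠ y →
      (G.Adj x y ↔ ((f x : ℕ) ≤ (f y : ℕ) + 1 ∧ (f y : ℕ) ≤ (f x : ℕ) + 1))

/-- `G` is an expansion of the cycle of length `k`. -/
def IsCycleExpansion {V : Type*} (G : SimpleGraph V) (k : ℕ) : Prop :=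
  ∃ f : V → ZMod k, Function.Surjective f ∧
    ∀ x y : V, x ≠ y →
      (G.Adj x y ↔ (f x = f y ∨ f x - f y = 1 ∨ f y - f x = 1))

/-- Indices at cyclic distance at most one. -/
def Near {k : ℕ} (i j : ZMod k) : Prop := i = j ∨ i - j = 1 ∨ j - i = 1

/-- The closed neighbourhood of `x` on `v` is the set of three consecutive vertices around
`v i`. -/
def IsCenter {V : Type*} (G : SimpleGraph V) {k : ℕ} (v : ZMod k → V) (x : V) (i : ZMod k) :
    Prop :=
  ∀ j, (x = v j ∨ G.Adj x (v j)) ↔ Near i j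

lemma ZMod.natCast_ne_zero_of_lt {k n : ℕ} (h0 : 0 < n) (hn : n < k) : ((n : ℕ) : ZMod k) ≠ 0 := by
  rw [Ne, ZMod.natCast_eq_zero_iff]
  exact Nat.not_dvd_of_pos_of_lt h0 hn

/-- The element `u = 1` is kept opaque so that `grind` can use the disequalities as
ring facts. -/
lemma ZMod.exists_eq_one_small_mul_ne_zero {k : ℕ} (hk : 6 ≤ k) :
    ∃ u : ZMod k, u = 1 ∧ u ≠ 0 ∧ 2 * u ≠ 0 ∧ 3 * u ≠ 0 ∧ 4 * u ≠ 0 ∧ 5 * u ≠ 0 := by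
  have h (n : ℕ) (h0 : 0 < n) (hn : n < 6) : ((n : ℕ) : ZMod k) ≠ 0 :=
    ZMod.natCast_ne_zero_of_lt h0 (by omega)
  simp only [exists_eq_left, mul_one]
  exact ⟨mod_cast h 1 (by simp) (by simp), mod_cast h 2 (by simp) (by simp),
    mod_cast h 3 (by simp) (by simp), mod_cast h 4 (by simp) (by simp),
    mod_cast h 5 (by simp) (by simp)⟩

section

variable {V : Type*} {G : SimpleGraph V} {k : ℕ} {v : ZMod k → V}

lemma IsInducedCycle.isCenter_self (hC : IsInducedCycle G k v) (i : ZMod k) :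
    IsCenter G v (v i) i := by
  intro j
  rw [hC.2, hC.1.eq_iff, Near]

lemma IsCenter.eq (hk : 6 ≤ k) {x : V} {i j : ZMod k} (hi : IsCenter G v x i)
    (hj : IsCenter G v x j) : i = j := by
  obtain ⟨u, hu, h1, h2, h3, h4, h5⟩ := ZMod.exists_eq_one_small_mul_ne_zero hk
  have h (m : ZMod k) : Near i m ↔ Near j m := (hi m).symm.trans (hj m)
  have a1 := h i
  have a2 := h (i + 1)
  have a3 := h (i - 1)
  simp only [Near] at a1 a2 a3
  grind

/-- A vertex off the cycle cannot see the first two and the last of four consecutive vertices. -/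
lemma IsInducedCycle.not_four_consecutive (hclaw : ClawFree G) (hbull : BullFree G)
    (hk : 6 ≤ k) (hC : IsInducedCycle G k v) {x : V} (hx : ∀ j, x ≠ v j) (a : ZMod k)
    (ha0 : G.Adj x (v a)) (ha1 : G.Adj x (v (a + 1)))
    (ha3 : G.Adj x (v (a + 3))) : False := by
  obtain ⟨u, hu, h1, h2, h3, h4, h5⟩ := ZMod.exists_eq_one_small_mul_ne_zero hk
  by_cases hp : G.Adj x (v (a - 1))
  · refine hclaw ⟨x, v (a - 1), v (a + 1), v (a + 3), ?_, ?_, ?_, hp, ha1, ha3, ?_, ?_, ?_⟩ <;>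
      simp only [ne_eq, hC.1.eq_iff, hC.2] <;> grind
  · refine hbull ⟨x, v a, v (a + 1), v (a + 3), v (a - 1), hx _, ?_, ?_, ?_, ?_, ha0, ?_,
      ha1.symm, ha3, ?_, ?_, ?_, hp, ?_, ?_⟩ <;>
      simp only [ne_eq, hC.1.eq_iff, hC.2] <;> grind

/-- A vertex off the cycle seeing two consecutive vertices sees a third one next to them. -/
lemma IsInducedCycle.adj_third (hbull : BullFree G)
    (hk : 6 ≤ k) (hC : IsInducedCycle G k v) {x : V} (hx : ∀ j, x ≠ v j) (a : ZMod k)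
    (ha0 : G.Adj x (v a)) (ha1 : G.Adj x (v (a + 1))) :
    G.Adj x (v (a - 1)) ∨ G.Adj x (v (a + 2)) := by
  obtain ⟨u, hu, h1, h2, h3, h4, h5⟩ := ZMod.exists_eq_one_small_mul_ne_zero hk
  by_contra! hn
  refine hbull ⟨v a, v (a + 1), x, v (a - 1), v (a + 2), ?_, ?_, hx _, hx _, ?_, ?_, ha1.symm,
    ha0, ?_, ?_, ?_, hn.1, ?_, hn.2, ?_⟩ <;>
    simp only [ne_eq, hC.1.eq_iff, hC.2] <;> grind

lemma IsInducedCycle.adj_next (hclaw : ClawFree G)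
    (hk : 6 ≤ k) (hC : IsInducedCycle G k v) {x : V} (hx : ∀ j, x ≠ v j) (a : ZMod k)
    (ha : G.Adj x (v a)) : G.Adj x (v (a - 1)) ∨ G.Adj x (v (a + 1)) := by
  obtain ⟨u, hu, h1, h2, h3, h4, h5⟩ := ZMod.exists_eq_one_small_mul_ne_zero hk
  by_contra! hn
  refine hclaw ⟨v a, x, v (a - 1), v (a + 1), hx _, hx _, ?_, ha.symm, ?_, ?_, hn.1, hn.2, ?_⟩ <;>
    simp only [ne_eq, hC.1.eq_iff, hC.2] <;> grind

lemma IsInducedCycle.exists_three_consecutive (hclaw : ClawFree G) (hbull : BullFree G)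
    (hk : 6 ≤ k) (hC : IsInducedCycle G k v) {x : V} (hx : ∀ j, x ≠ v j) {a : ZMod k}
    (ha : G.Adj x (v a)) :
    ∃ c, G.Adj x (v (c - 1)) ∧ G.Adj x (v c) ∧ G.Adj x (v (c + 1)) := by
  have key (b : ZMod k) (hb0 : G.Adj x (v b)) (hb1 : G.Adj x (v (b + 1))) :
      ∃ c, G.Adj x (v (c - 1)) ∧ G.Adj x (v c) ∧ G.Adj x (v (c + 1)) := by
    rcases hC.adj_third hbull hk hx b hb0 hb1 with h | h
    · exact ⟨b, h, hb0, hb1⟩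
    · exact ⟨b + 1, by simpa using hb0, hb1, by rwa [add_assoc, one_add_one_eq_two]⟩
  rcases hC.adj_next hclaw hk hx a ha with h | h
  · exact key (a - 1) h (by simpa using ha)
  · exact key a ha h

lemma IsInducedCycle.exists_isCenter (hclaw : ClawFree G) (hbull : BullFree G)
    (hk : 6 ≤ k) (hC : IsInducedCycle G k v) {x : V} {a : ZMod k}
    (ha : x = v a ∨ G.Adj x (v a)) : ∃ i, IsCenter G v x i := by
  by_cases hx : ∃ j, x = v j
  · obtain ⟨j, rfl⟩ := hx
    exact ⟨j, hC.isCenter_self j⟩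
  push Not at hx
  obtain ⟨c, hc0, hc1, hc2⟩ :=
    hC.exists_three_consecutive hclaw hbull hk hx (ha.resolve_left (hx a))
  refine ⟨c, fun j => ⟨fun hj => ?_, fun hj => ?_⟩⟩
  · obtain ⟨u, hu, h1, h2, h3, h4, h5⟩ := ZMod.exists_eq_one_small_mul_ne_zero hk
    replace hj := hj.resolve_left (hx j)
    by_contra hn
    have e1 : j ≠ c + 2 := by
      rintro rfl
      refine hC.not_four_consecutive hclaw hbull hk hx (c - 1) hc0 ?_ ?_
      · convert hc1 using 2; ring
      · convert hj using 2; ring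
    have e2 : j ≠ c - 2 := by
      rintro rfl
      refine hC.not_four_consecutive hclaw hbull hk hx (c - 2) hj ?_ ?_
      · convert hc0 using 2; ring
      · convert hc2 using 2; ring
    simp only [Near] at hn
    refine hclaw ⟨x, v (c - 1), v (c + 1), v j, ?_, ?_, ?_, hc0, hc2, hj, ?_, ?_, ?_⟩ <;>
      simp only [ne_eq, hC.1.eq_iff, hC.2] <;> grind
  · rcases hj with rfl | hj | hj
    · exact .inr hc1
    · obtain rfl : j = c - 1 := by grind
      exact .inr hc0
    · obtain rfl : j = c + 1 := by grind
      exact .inr hc2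

/-- In a connected claw-free and bull-free graph, a long induced cycle is dominating. -/
lemma IsInducedCycle.isCenter_of_connected (hconn : G.Connected) (hclaw : ClawFree G)
    (hbull : BullFree G) (hk : 6 ≤ k) (hC : IsInducedCycle G k v) (x : V) :
    ∃ i, IsCenter G v x i := by
  have step (y z : V) (hy : ∃ i, IsCenter G v y i) (hyz : G.Adj y z) :
      ∃ i, IsCenter G v z i := by
    obtain ⟨u, hu, h1, h2, h3, h4, h5⟩ := ZMod.exists_eq_one_small_mul_ne_zero hk
    obtain ⟨i, hi⟩ := hy
    by_cases hy' : ∃ j, y = v j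
    · obtain ⟨j, rfl⟩ := hy'
      exact hC.exists_isCenter hclaw hbull hk (.inr hyz.symm)
    push Not at hy'
    by_contra hn
    have hz (j : ZMod k) : ¬ (z = v j ∨ G.Adj z (v j)) := fun h =>
      hn (hC.exists_isCenter hclaw hbull hk h)
    have b1 := ((hi (i - 1)).2 (by simp [Near])).resolve_left (hy' _)
    have b2 := ((hi (i + 1)).2 (by simp [Near])).resolve_left (hy' _)
    have z1 := hz (i - 1)
    have z2 := hz (i + 1)
    push Not at z1 z2
    refine hclaw ⟨y, z, v (i - 1), v (i + 1), z1.1, z2.1, ?_, hyz, b1, b2, z1.2, z2.2, ?_⟩ <;>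
      simp only [ne_eq, hC.1.eq_iff, hC.2] <;> grind
  have walk (y z : V) (p : G.Walk y z) :
      (∃ i, IsCenter G v y i) → ∃ i, IsCenter G v z i := by
    induction p with
    | nil => exact id
    | cons h _ ih => exact fun hy => ih (step _ _ hy h)
  obtain ⟨p⟩ := hconn.preconnected (v 0) x
  exact walk _ _ p ⟨0, hC.isCenter_self 0⟩

/-- A vertex of an induced cycle may be replaced by any vertex centered at it. -/
lemma IsInducedCycle.update (hC : IsInducedCycle G k v) {x : V} {i : ZMod k}
    (hx : ∀ j, x ≠ v j) (hi : IsCenter G v x i) :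
    IsInducedCycle G k (Function.update v i x) := by
  have hadj (j : ZMod k) : G.Adj x (v j) ↔ Near i j := by
    rw [← hi j, or_iff_right (hx j)]
  have hinj := hC.1
  have hC2 := hC.2
  refine ⟨fun a b hab => ?_, fun a b => ?_⟩
  · simp only [Function.update_apply] at hab
    split_ifs at hab with h1 h2 h2
    · rw [h1, h2]
    · exact absurd hab (hx b)
    · exact absurd hab.symm (hx a)
    · exact hinj hab
  · simp only [Function.update_apply]
    split_ifs with h1 h2 h2
    · rw [h1, h2]
      simpa using hC2 i i
    · rw [h1, hadj, Near]
      grind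
    · rw [h2, G.adj_comm, hadj, Near]
      grind
    · exact hC2 a b

lemma eq_of_near_iff_of_ne (hk : 6 ≤ k) {i j j' : ZMod k}
    (h : ∀ m, m ≠ i → (Near j m ↔ Near j' m)) : j = j' := by
  obtain ⟨u, hu, h1, h2, h3, h4, h5⟩ := ZMod.exists_eq_one_small_mul_ne_zero hk
  have a0 (hm : j ≠ i) := (h j hm).1 (by simp [Near])
  have a1 (hm : j + 1 ≠ i) := (h (j + 1) hm).1 (by simp [Near])
  have a2 (hm : j - 1 ≠ i) := (h (j - 1) hm).1 (by simp [Near])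
  have b0 (hm : j' ≠ i) := (h j' hm).2 (by simp [Near])
  have b1 (hm : j' + 1 ≠ i) := (h (j' + 1) hm).2 (by simp [Near])
  have b2 (hm : j' - 1 ≠ i) := (h (j' - 1) hm).2 (by simp [Near])
  simp only [Near, ← hu] at a0 a1 a2 b0 b1 b2
  by_cases hj : j = i
  · rcases a1 (by grind) with h | h | h <;> rcases a2 (by grind) with h' | h' | h' <;> grind
  by_cases hj' : j' = i
  · rcases b1 (by grind) with h | h | h <;> rcases b2 (by grind) with h' | h' | h' <;> grind
  rcases a0 hj with h | h | h
  · exact h.symm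
  · by_cases hi : j - u = i
    · rcases b1 (by grind) with h' | h' | h' <;> grind
    · rcases a2 hi with h' | h' | h' <;> grind
  · by_cases hi : j + u = i
    · rcases b2 (by grind) with h' | h' | h' <;> grind
    · rcases a1 hi with h' | h' | h' <;> grind

lemma IsInducedCycle.adj_iff_near (hclaw : ClawFree G)
    (hbull : BullFree G) (hk : 6 ≤ k) (hC : IsInducedCycle G k v) {x y : V} (hxy : x ≠ y)
    {i j : ZMod k} (hi : IsCenter G v x i) (hj : IsCenter G v y j) :
    G.Adj x y ↔ Near i j := by
  by_cases hy : ∃ m, y = v m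
  · obtain ⟨m, rfl⟩ := hy
    obtain rfl := (hC.isCenter_self m).eq hk hj
    rw [← hi m, or_iff_right hxy]
  by_cases hx : ∃ m, x = v m
  · obtain ⟨m, rfl⟩ := hx
    obtain rfl := (hC.isCenter_self m).eq hk hi
    have h := hj m
    rw [or_iff_right hxy.symm] at h
    rw [G.adj_comm, h, Near, Near]
    grind
  push Not at hx hy
  have hC' := hC.update hx hi
  obtain ⟨m, hmi, hm⟩ : ∃ m, m ≠ i ∧ Near j m := by
    obtain ⟨u, hu, h1, -⟩ := ZMod.exists_eq_one_small_mul_ne_zero hk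
    by_cases h : j = i
    · exact ⟨j + 1, by simpa [h, ← hu] using h1, by simp [Near]⟩
    · exact ⟨j, h, .inl rfl⟩
  obtain ⟨j', hj'⟩ := hC'.exists_isCenter hclaw hbull hk (x := y) (a := m)
    (by rw [Function.update_of_ne hmi]; exact (hj m).2 hm)
  have hjj : j = j' := eq_of_near_iff_of_ne hk (i := i) fun m hm => by
    rw [← hj m, ← hj' m, Function.update_of_ne hm]
  have := hj' i
  rw [Function.update_self, or_iff_right hxy.symm, ← hjj, G.adj_comm] at this
  rw [this, Near, Near]
  grind

end

/-- A connected (claw, bull)-free graph containing an induced cycle of length `k ≥ 6` is an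
expansion of the cycle of length `k`. -/
theorem cycleExpansion_of_long_induced_cycle {V : Type*} [Fintype V] (G : SimpleGraph V)
    (hconn : G.Connected) (hclaw : ClawFree G) (hbull : BullFree G)
    (k : ℕ) (hk : 6 ≤ k) (v : ZMod k → V) (hC : IsInducedCycle G k v) :
    IsCycleExpansion G k := by
  choose f hf using hC.isCenter_of_connected hconn hclaw hbull hk
  exact ⟨f, fun i => ⟨v i, (hf (v i)).eq hk (hC.isCenter_self i)⟩,
    fun x y hxy => hC.adj_iff_near hclaw hbull hk hxy (hf x) (hf y)⟩
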